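/- Assume ψ : ℝ^N → ℂ is smooth, ℤ^N-periodic, with ∫_{[0,1]^N}|ψ|²dy = 1 and 𝔸ψ = 0. Fix h, l ∈ {1,…,N}, let A₁h, A₁l, A₂ : ℝ^N → ℝ^{N×N} be smooth ℤ^N-periodic symmetric-matrix-valued functions and c₁h, c₁l, c₂ : ℝ^N → ℝ smooth ℤ^N-periodic functions. Assume χ_h, χ_l : ℝ^N → ℂ are smooth ℤ^N-periodic functions satisfying 𝔸χ_m = div(A₁m(∇+2iπθ⁰)ψ) + 2iπθ⁰·(A₁m(∇+2iπθ⁰)ψ) − c₁m ψ for m ∈ {h, l}. Assume moreover that there exist a smooth ℤ^N-periodic function ξ and a constant Λ ∈ ℂ such that 𝔸ξ = div(A₂(∇+2iπθ⁰)ψ) + 2iπθ⁰·(A₂(∇+2iπθ⁰)ψ) − c₂ψ + div(A₁h(∇+2iπθ⁰)χ_l) + 2iπθ⁰·(A₁h(∇+2iπθ⁰)χ_l) − c₁h χ_l + div(A₁l(∇+2iπθ⁰)χ_h) + 2iπθ⁰·(A₁l(∇+2iπθ⁰)χ_h) − c₁l χ_h + Λψ. Then ∫_{[0,1]^N}[ A₂(∇+2iπθ⁰)ψ·(∇−2iπθ⁰)conj(ψ)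 + (c₂ − Λ)|ψ|² ] dy + ∫_{[0,1]^N}[ A₁h(∇+2iπθ⁰)χ_l·(∇−2iπθ⁰)conj(ψ) + c₁h χ_l conj(ψ) ] dy + ∫_{[0,1]^N}[ A₁l(∇+2iπθ⁰)χ_h·(∇−2iπθ⁰)conj(ψ) + c₁l χ_h conj(ψ) ] dy = 0. -/

import Mathlib

open MeasureTheory Real ComplexConjugate

/-- Partial derivative `∂ₖ f` of a function on `ℝ^N`. -/
noncomputable def pd {N : ℕ} (f : (Fin N → ℝ) → ℂ) (k : Fin N) (y : Fin N → ℝ) : ℂ :=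
  fderiv ℝ f y (Pi.single k 1)

/-- `ℤ^N`-periodicity. -/
def ZNPeriodic {N : ℕ} {α : Type*} (f : (Fin N → ℝ) → α) : Prop :=
  ∀ q : Fin N → ℤ, ∀ y : Fin N → ℝ, f (fun i => y i + (q i : ℝ)) = f y

/-- `l`-th component of `(∇ + 2iπθ)χ`. -/
noncomputable def gp {N : ℕ} (θ : Fin N → ℝ) (χ : (Fin N → ℝ) → ℂ) (l : Fin N)
    (y : Fin N → ℝ) : ℂ :=
  pd χ l y + 2 * (π : ℂ) * Complex.I * (θ l : ℂ) * χ y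

/-- `j`-th component of `(∇ − 2iπθ)conj(ψ)`. -/
noncomputable def gm {N : ℕ} (θ : Fin N → ℝ) (ψ : (Fin N → ℝ) → ℂ) (j : Fin N)
    (y : Fin N → ℝ) : ℂ :=
  conj (pd ψ j y) - 2 * (π : ℂ) * Complex.I * (θ j : ℂ) * conj (ψ y)

/-- The shifted Bloch cell operator
`𝔸χ = −div(A(∇χ + 2iπθχ)) − 2iπθ·(A(∇χ + 2iπθχ)) + (c − λ)χ`. -/
noncomputable def blochOp {N : ℕ} (A : (Fin N → ℝ) → Fin N → Fin N → ℝ)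
    (c : (Fin N → ℝ) → ℝ) (lam : ℝ) (θ : Fin N → ℝ)
    (χ : (Fin N → ℝ) → ℂ) (y : Fin N → ℝ) : ℂ :=
  - (∑ k : Fin N, fderiv ℝ
      (fun y' => ∑ l : Fin N, (A y' k l : ℂ) * gp θ χ l y') y (Pi.single k 1))
  - (∑ k : Fin N, 2 * (π : ℂ) * Complex.I * (θ k : ℂ)
      * (∑ l : Fin N, (A y k l : ℂ) * gp θ χ l y))
  + ((c y : ℂ) - (lam : ℂ)) * χ y

/-- The right hand side `div(A₁(∇+2iπθ)χ) + 2iπθ·(A₁(∇+2iπθ)χ) − c₁χ`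
of the `x`-differentiated cell equation. -/
noncomputable def dcellx {N : ℕ} (A₁ : (Fin N → ℝ) → Fin N → Fin N → ℝ)
    (c₁ : (Fin N → ℝ) → ℝ) (θ : Fin N → ℝ) (χ : (Fin N → ℝ) → ℂ) (y : Fin N → ℝ) : ℂ :=
  (∑ k : Fin N, fderiv ℝ
      (fun y' => ∑ l : Fin N, (A₁ y' k l : ℂ) * gp θ χ l y') y (Pi.single k 1))
  + (∑ k : Fin N, 2 * (π : ℂ) * Complex.I * (θ k : ℂ)
      * (∑ l : Fin N, (A₁ y k l : ℂ) * gp θ χ l y))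
  - (c₁ y : ℂ) * χ y

/-- The unit cell `[0,1]^N`. -/
def unitCell (N : ℕ) : Set (Fin N → ℝ) := Set.univ.pi fun _ => Set.Icc (0 : ℝ) 1

theorem pd_contDiff {N : ℕ} {f : (Fin N → ℝ) → ℂ} (hf : ContDiff ℝ (⊤ : ℕ∞) f) (k : Fin N) :
    ContDiff ℝ (⊤ : ℕ∞) (pd f k) := by
  unfold pd
  exact (hf.fderiv_right (m := ((⊤ : ℕ∞) : WithTop ℕ∞)) (by simp)).clm_apply contDiff_const

theorem pd_periodic {N : ℕ} {f : (Fin N → ℝ) → ℂ} (hf : ZNPeriodic f) (k : Fin N) :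
    ZNPeriodic (pd f k) := by
  intro q y
  have h1 : (fun x => f (x + fun i => (q i : ℝ))) = f := by
    funext x; exact hf q x
  have h2 := fderiv_comp_add_right (𝕜 := ℝ) (f := f) (x := y) (fun i => (q i : ℝ))
  rw [h1] at h2
  unfold pd
  rw [h2]
  rfl

theorem gp_contDiff {N : ℕ} (θ : Fin N → ℝ) {f : (Fin N → ℝ) → ℂ}
    (hf : ContDiff ℝ (⊤ : ℕ∞) f) (k : Fin N) : ContDiff ℝ (⊤ : ℕ∞) (gp θ f k) := by
  unfold gp
  exact (pd_contDiff hf k).add (contDiff_const.mul hf)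

theorem gp_periodic {N : ℕ} (θ : Fin N → ℝ) {f : (Fin N → ℝ) → ℂ} (hf : ZNPeriodic f)
    (k : Fin N) : ZNPeriodic (gp θ f k) := by
  intro q y
  unfold gp
  rw [pd_periodic hf k q y, hf q y]

/-- The flux `B (∇ + 2iπθ) χ`. -/
noncomputable def flux {N : ℕ} (B : (Fin N → ℝ) → Fin N → Fin N → ℝ) (θ : Fin N → ℝ)
    (χ : (Fin N → ℝ) → ℂ) (k : Fin N) (y : Fin N → ℝ) : ℂ :=
  ∑ l : Fin N, (B y k l : ℂ) * gp θ χ l y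

theorem flux_contDiff {N : ℕ} {B : (Fin N → ℝ) → Fin N → Fin N → ℝ} (θ : Fin N → ℝ)
    {χ : (Fin N → ℝ) → ℂ} (hB : ∀ k l, ContDiff ℝ (⊤ : ℕ∞) (fun y => B y k l))
    (hf : ContDiff ℝ (⊤ : ℕ∞) χ) (k : Fin N) : ContDiff ℝ (⊤ : ℕ∞) (flux B θ χ k) := by
  unfold flux
  exact ContDiff.sum fun l _ =>
    (Complex.ofRealCLM.contDiff.comp (hB k l)).mul (gp_contDiff θ hf l)

theorem flux_periodic {N : ℕ} {B : (Fin N → ℝ) → Fin N → Fin N → ℝ} (θ : Fin N → ℝ)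
    {χ : (Fin N → ℝ) → ℂ} (hB : ∀ k l, ZNPeriodic (fun y => B y k l))
    (hf : ZNPeriodic χ) (k : Fin N) : ZNPeriodic (flux B θ χ k) := by
  intro q y
  unfold flux
  refine Finset.sum_congr rfl fun l _ => ?_
  have := hB k l q y
  simp only at this
  rw [gp_periodic θ hf l q y, this]

theorem unitCell_eq (N : ℕ) : unitCell N = Set.Icc (0 : Fin N → ℝ) 1 := by
  unfold unitCell
  rw [← Set.pi_univ_Icc]
  rfl

theorem cell_integrable {N : ℕ} {f : (Fin N → ℝ) → ℂ} (hf : Continuous f) :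
    IntegrableOn f (unitCell N) := by
  rw [unitCell_eq]
  exact hf.continuousOn.integrableOn_compact isCompact_Icc

theorem div_integral {N : ℕ} (F : Fin N → (Fin N → ℝ) → ℂ)
    (hF : ∀ k, ContDiff ℝ (⊤ : ℕ∞) (F k)) (hp : ∀ k, ZNPeriodic (F k)) :
    ∫ y in unitCell N, ∑ k, pd (F k) k y = 0 := by
  have hi : IntegrableOn (fun y => ∑ k, pd (F k) k y) (unitCell N) :=
    cell_integrable (continuous_finsetSum _ fun k _ => (pd_contDiff (hF k) k).continuous)
  rcases N with _ | n
  · simp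
  · rw [unitCell_eq] at hi ⊢
    have key := integral_divergence_of_hasFDerivAt_off_countable' (0 : Fin (n+1) → ℝ) 1
      (fun _ => zero_le_one) F (fun k y => fderiv ℝ (F k) y) ∅ Set.countable_empty
      (fun k => (hF k).continuous.continuousOn)
      (fun x _ k => ((hF k).differentiable (by simp) x).hasFDerivAt) hi
    refine key.trans (Finset.sum_eq_zero fun k _ => sub_eq_zero.2 ?_)
    congr 1
    funext x
    rw [← hp k (Pi.single k 1) (Fin.insertNth k ((0 : Fin (n+1) → ℝ) k) x)]
    congr 1
    funext i
    refine Fin.succAboveCases k ?_ (fun j => ?_) i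
    · simp
    · simp

theorem conj_contDiff {N : ℕ} {f : (Fin N → ℝ) → ℂ} (hf : ContDiff ℝ (⊤ : ℕ∞) f) :
    ContDiff ℝ (⊤ : ℕ∞) (fun y => conj (f y)) :=
  Complex.conjCLE.contDiff.comp hf

theorem pd_mul_conj {N : ℕ} {F f : (Fin N → ℝ) → ℂ} (hF : ContDiff ℝ (⊤ : ℕ∞) F)
    (hf : ContDiff ℝ (⊤ : ℕ∞) f) (k : Fin N) (y : Fin N → ℝ) :
    pd (fun y => F y * conj (f y)) k y = pd F k y * conj (f y) + F y * conj (pd f k y) := by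
  have h1 := ((hF.differentiable (by simp)) y).hasFDerivAt
  have h2 := ((hf.differentiable (by simp)) y).hasFDerivAt
  have h3 : HasFDerivAt (fun y => conj (f y))
      ((Complex.conjCLE : ℂ →L[ℝ] ℂ).comp (fderiv ℝ f y)) y :=
    (Complex.conjCLE : ℂ →L[ℝ] ℂ).hasFDerivAt.comp y h2
  have h4 := (h1.mul h3).fderiv
  unfold pd
  have h5 : fderiv ℝ (fun y => F y * conj (f y)) y = _ := h4
  rw [h5]
  simp
  ring

theorem gm_continuous {N : ℕ} (θ : Fin N → ℝ) {f : (Fin N → ℝ) → ℂ}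
    (hf : ContDiff ℝ (⊤ : ℕ∞) f) (k : Fin N) : Continuous (gm θ f k) := by
  unfold gm
  exact ((conj_contDiff (pd_contDiff hf k)).continuous).sub
    (continuous_const.mul (conj_contDiff hf).continuous)

theorem dcellx_eq {N : ℕ} (B : (Fin N → ℝ) → Fin N → Fin N → ℝ) (b : (Fin N → ℝ) → ℝ)
    (θ : Fin N → ℝ) (χ : (Fin N → ℝ) → ℂ) (y : Fin N → ℝ) :
    dcellx B b θ χ y = (∑ k, pd (flux B θ χ k) k y)
      + (∑ k, 2 * (π : ℂ) * Complex.I * (θ k : ℂ) * flux B θ χ k y) - (b y : ℂ) * χ y := rfl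

/-- The integrand of the weak form. -/
noncomputable def wform {N : ℕ} (B : (Fin N → ℝ) → Fin N → Fin N → ℝ) (b : (Fin N → ℝ) → ℝ)
    (θ : Fin N → ℝ) (χ ψ : (Fin N → ℝ) → ℂ) (y : Fin N → ℝ) : ℂ :=
  (∑ k : Fin N, flux B θ χ k y * gm θ ψ k y) + (b y : ℂ) * χ y * conj (ψ y)

theorem wform_integrable {N : ℕ} {B : (Fin N → ℝ) → Fin N → Fin N → ℝ} {b : (Fin N → ℝ) → ℝ}
    (θ : Fin N → ℝ) {χ ψ : (Fin N → ℝ) → ℂ}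
    (hB : ∀ k l, ContDiff ℝ (⊤ : ℕ∞) (fun y => B y k l)) (hb : ContDiff ℝ (⊤ : ℕ∞) b)
    (hχ : ContDiff ℝ (⊤ : ℕ∞) χ) (hψ : ContDiff ℝ (⊤ : ℕ∞) ψ) :
    IntegrableOn (wform B b θ χ ψ) (unitCell N) := by
  apply cell_integrable
  unfold wform
  exact (continuous_finsetSum _ fun k _ =>
    (flux_contDiff θ hB hχ k).continuous.mul (gm_continuous θ hψ k)).add
    (((Complex.continuous_ofReal.comp hb.continuous).mul hχ.continuous).mul
      (conj_contDiff hψ).continuous)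

theorem dcellx_continuous {N : ℕ} {B : (Fin N → ℝ) → Fin N → Fin N → ℝ} {b : (Fin N → ℝ) → ℝ}
    (θ : Fin N → ℝ) {χ : (Fin N → ℝ) → ℂ}
    (hB : ∀ k l, ContDiff ℝ (⊤ : ℕ∞) (fun y => B y k l)) (hb : ContDiff ℝ (⊤ : ℕ∞) b)
    (hχ : ContDiff ℝ (⊤ : ℕ∞) χ) : Continuous (dcellx B b θ χ) := by
  rw [funext (dcellx_eq B b θ χ)]
  exact ((continuous_finsetSum _ fun k _ =>
    (pd_contDiff (flux_contDiff θ hB hχ k) k).continuous).add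
    (continuous_finsetSum _ fun k _ =>
      continuous_const.mul (flux_contDiff θ hB hχ k).continuous)).sub
    ((Complex.continuous_ofReal.comp hb.continuous).mul hχ.continuous)

theorem weak_form {N : ℕ} {B : (Fin N → ℝ) → Fin N → Fin N → ℝ} {b : (Fin N → ℝ) → ℝ}
    (θ : Fin N → ℝ) {χ ψ : (Fin N → ℝ) → ℂ}
    (hB : ∀ k l, ContDiff ℝ (⊤ : ℕ∞) (fun y => B y k l)) (hb : ContDiff ℝ (⊤ : ℕ∞) b)
    (hχ : ContDiff ℝ (⊤ : ℕ∞) χ) (hψ : ContDiff ℝ (⊤ : ℕ∞) ψ)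
    (hBp : ∀ k l, ZNPeriodic (fun y => B y k l))
    (hχp : ZNPeriodic χ) (hψp : ZNPeriodic ψ) :
    ∫ y in unitCell N, dcellx B b θ χ y * conj (ψ y) = - ∫ y in unitCell N, wform B b θ χ ψ y := by
  have hi : IntegrableOn (fun y => dcellx B b θ χ y * conj (ψ y)) (unitCell N) :=
    cell_integrable ((dcellx_continuous θ hB hb hχ).mul (conj_contDiff hψ).continuous)
  rw [eq_neg_iff_add_eq_zero, ← integral_add hi (wform_integrable θ hB hb hχ hψ)]
  rw [← div_integral (fun k y => flux B θ χ k y * conj (ψ y))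
    (fun k => (flux_contDiff θ hB hχ k).mul (conj_contDiff hψ))
    (fun k q y => by
      have h1 := flux_periodic θ hBp hχp k q y
      have h2 := hψp q y
      simp only [h1, h2])]
  congr 1
  funext y
  simp only [pd_mul_conj (flux_contDiff θ hB hχ _) hψ]
  rw [dcellx_eq, wform, sub_mul, add_mul, Finset.sum_mul, Finset.sum_mul,
    sub_add_add_cancel, ← Finset.sum_add_distrib, ← Finset.sum_add_distrib]
  refine Finset.sum_congr rfl fun k _ => ?_
  unfold gm
  ring

theorem blochOp_eq {N : ℕ} (A : (Fin N → ℝ) → Fin N → Fin N → ℝ) (c : (Fin N → ℝ) → ℝ) (lam : ℝ)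
    (θ : Fin N → ℝ) (χ : (Fin N → ℝ) → ℂ) (y : Fin N → ℝ) :
    blochOp A c lam θ χ y = - dcellx A (fun y => c y - lam) θ χ y := by
  unfold blochOp dcellx
  push_cast
  ring

theorem conj_gp {N : ℕ} (θ : Fin N → ℝ) (χ : (Fin N → ℝ) → ℂ) (k : Fin N) (y : Fin N → ℝ) :
    conj (gp θ χ k y) = gm θ χ k y := by
  have h2 : conj (2 : ℂ) = 2 := Complex.conj_ofNat 2
  unfold gp gm
  simp only [map_add, map_mul, h2, Complex.conj_ofReal, Complex.conj_I]
  ring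

theorem conj_gm {N : ℕ} (θ : Fin N → ℝ) (χ : (Fin N → ℝ) → ℂ) (k : Fin N) (y : Fin N → ℝ) :
    conj (gm θ χ k y) = gp θ χ k y := by
  rw [← conj_gp, Complex.conj_conj]

theorem wform_symm {N : ℕ} {B : (Fin N → ℝ) → Fin N → Fin N → ℝ} (b : (Fin N → ℝ) → ℝ)
    (θ : Fin N → ℝ) (χ ψ : (Fin N → ℝ) → ℂ) (hB : ∀ y k l, B y k l = B y l k) (y : Fin N → ℝ) :
    wform B b θ χ ψ y = conj (wform B b θ ψ χ y) := by
  unfold wform flux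
  simp only [map_add, map_sum, map_mul, conj_gp, conj_gm, Complex.conj_ofReal, Complex.conj_conj,
    Finset.sum_mul]
  congr 1
  · rw [Finset.sum_comm]
    refine Finset.sum_congr rfl fun k _ => Finset.sum_congr rfl fun m _ => ?_
    rw [hB y m k]; ring
  · ring

theorem x_hessian_identity
    (N : ℕ) (hN : 1 ≤ N) (θ : Fin N → ℝ)
    (A : (Fin N → ℝ) → Fin N → Fin N → ℝ)
    (hA_reg : ∀ k l, ContDiff ℝ (⊤ : ℕ∞) (fun y => A y k l))
    (hA_per : ∀ k l, ZNPeriodic (fun y => A y k l))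
    (hA_symm : ∀ y k l, A y k l = A y l k)
    (c : (Fin N → ℝ) → ℝ) (hc_reg : ContDiff ℝ (⊤ : ℕ∞) c) (hc_per : ZNPeriodic c)
    (lam : ℝ)
    (ψ : (Fin N → ℝ) → ℂ)
    (hψ_reg : ContDiff ℝ (⊤ : ℕ∞) ψ) (hψ_per : ZNPeriodic ψ)
    (hψ_norm : ∫ y in unitCell N, ‖ψ y‖ ^ 2 = 1)
    (hψ_eq : ∀ y, blochOp A c lam θ ψ y = 0)
    (h l : Fin N)
    (A₁h A₁l A₂ : (Fin N → ℝ) → Fin N → Fin N → ℝ)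
    (hA₁h_reg : ∀ k m, ContDiff ℝ (⊤ : ℕ∞) (fun y => A₁h y k m))
    (hA₁h_per : ∀ k m, ZNPeriodic (fun y => A₁h y k m))
    (hA₁h_symm : ∀ y k m, A₁h y k m = A₁h y m k)
    (hA₁l_reg : ∀ k m, ContDiff ℝ (⊤ : ℕ∞) (fun y => A₁l y k m))
    (hA₁l_per : ∀ k m, ZNPeriodic (fun y => A₁l y k m))
    (hA₁l_symm : ∀ y k m, A₁l y k m = A₁l y m k)
    (hA₂_reg : ∀ k m, ContDiff ℝ (⊤ : ℕ∞) (fun y => A₂ y k m))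
    (hA₂_per : ∀ k m, ZNPeriodic (fun y => A₂ y k m))
    (hA₂_symm : ∀ y k m, A₂ y k m = A₂ y m k)
    (c₁h c₁l c₂ : (Fin N → ℝ) → ℝ)
    (hc₁h_reg : ContDiff ℝ (⊤ : ℕ∞) c₁h) (hc₁h_per : ZNPeriodic c₁h)
    (hc₁l_reg : ContDiff ℝ (⊤ : ℕ∞) c₁l) (hc₁l_per : ZNPeriodic c₁l)
    (hc₂_reg : ContDiff ℝ (⊤ : ℕ∞) c₂) (hc₂_per : ZNPeriodic c₂)
    (χh χl : (Fin N → ℝ) → ℂ)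
    (hχh_reg : ContDiff ℝ (⊤ : ℕ∞) χh) (hχh_per : ZNPeriodic χh)
    (hχl_reg : ContDiff ℝ (⊤ : ℕ∞) χl) (hχl_per : ZNPeriodic χl)
    (hχh_eq : ∀ y, blochOp A c lam θ χh y = dcellx A₁h c₁h θ ψ y)
    (hχl_eq : ∀ y, blochOp A c lam θ χl y = dcellx A₁l c₁l θ ψ y)
    (ξ : (Fin N → ℝ) → ℂ) (Λ : ℂ)
    (hξ_reg : ContDiff ℝ (⊤ : ℕ∞) ξ) (hξ_per : ZNPeriodic ξ)
    (hξ_eq : ∀ y, blochOp A c lam θ ξ y =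
      dcellx A₂ c₂ θ ψ y + dcellx A₁h c₁h θ χl y + dcellx A₁l c₁l θ χh y + Λ * ψ y) :
    (∫ y in unitCell N,
        ((∑ k : Fin N, (∑ m : Fin N, (A₂ y k m : ℂ) * gp θ ψ m y) * gm θ ψ k y)
          + ((c₂ y : ℂ) - Λ) * ((‖ψ y‖ ^ 2 : ℝ) : ℂ)))
    + (∫ y in unitCell N,
        ((∑ k : Fin N, (∑ m : Fin N, (A₁h y k m : ℂ) * gp θ χl m y) * gm θ ψ k y)
          + (c₁h y : ℂ) * χl y * conj (ψ y)))
    + (∫ y in unitCell N,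
        ((∑ k : Fin N, (∑ m : Fin N, (A₁l y k m : ℂ) * gp θ χh m y) * gm θ ψ k y)
          + (c₁l y : ℂ) * χh y * conj (ψ y))) = 0 := by
  have hb : ContDiff ℝ (⊤ : ℕ∞) (fun y => c y - lam) := hc_reg.sub contDiff_const
  -- the left-hand side tested against conj ψ vanishes
  have hL : ∫ y in unitCell N, dcellx A (fun y => c y - lam) θ ξ y * conj (ψ y) = 0 := by
    rw [weak_form θ hA_reg hb hξ_reg hψ_reg hA_per hξ_per hψ_per]
    simp only [wform_symm (fun y => c y - lam) θ ξ ψ hA_symm]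
    rw [integral_conj]
    have h1 := weak_form θ hA_reg hb hψ_reg hξ_reg hA_per hψ_per hξ_per
    have h2 : ∀ y, dcellx A (fun y => c y - lam) θ ψ y = 0 := fun y => by
      have := hψ_eq y
      rwa [blochOp_eq, neg_eq_zero] at this
    simp only [h2, zero_mul, integral_zero] at h1
    rw [neg_eq_zero.1 h1.symm]
    simp
  have w2 := weak_form θ hA₂_reg hc₂_reg hψ_reg hψ_reg hA₂_per hψ_per hψ_per
  have wh := weak_form θ hA₁h_reg hc₁h_reg hχl_reg hψ_reg hA₁h_per hχl_per hψ_per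
  have wl := weak_form θ hA₁l_reg hc₁l_reg hχh_reg hψ_reg hA₁l_per hχh_per hψ_per
  have hcψ := (conj_contDiff hψ_reg).continuous
  have i2 : IntegrableOn (fun y => dcellx A₂ c₂ θ ψ y * conj (ψ y)) (unitCell N) :=
    cell_integrable ((dcellx_continuous θ hA₂_reg hc₂_reg hψ_reg).mul hcψ)
  have ih : IntegrableOn (fun y => dcellx A₁h c₁h θ χl y * conj (ψ y)) (unitCell N) :=
    cell_integrable ((dcellx_continuous θ hA₁h_reg hc₁h_reg hχl_reg).mul hcψ)
  have il : IntegrableOn (fun y => dcellx A₁l c₁l θ χh y * conj (ψ y)) (unitCell N) :=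
    cell_integrable ((dcellx_continuous θ hA₁l_reg hc₁l_reg hχh_reg).mul hcψ)
  have iΛ : IntegrableOn (fun y => Λ * (ψ y * conj (ψ y))) (unitCell N) :=
    cell_integrable ((continuous_const (y := Λ)).mul (hψ_reg.continuous.mul hcψ))
  have hS : ∫ y in unitCell N, (dcellx A₂ c₂ θ ψ y * conj (ψ y)
      + dcellx A₁h c₁h θ χl y * conj (ψ y) + dcellx A₁l c₁l θ χh y * conj (ψ y)
      + Λ * (ψ y * conj (ψ y))) = 0 := by
    rw [← neg_eq_zero, ← integral_neg, ← hL]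
    congr 1
    funext y
    have := hξ_eq y
    rw [blochOp_eq] at this
    linear_combination (conj (ψ y)) * this
  have i2h : IntegrableOn (fun y => dcellx A₂ c₂ θ ψ y * conj (ψ y)
      + dcellx A₁h c₁h θ χl y * conj (ψ y)) (unitCell N) := i2.add ih
  have i2hl : IntegrableOn (fun y => dcellx A₂ c₂ θ ψ y * conj (ψ y)
      + dcellx A₁h c₁h θ χl y * conj (ψ y) + dcellx A₁l c₁l θ χh y * conj (ψ y))
      (unitCell N) := i2h.add il
  rw [integral_add i2hl iΛ, integral_add i2h il, integral_add i2 ih, w2, wh, wl] at hS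
  have h0 : (∫ y in unitCell N,
        ((∑ k : Fin N, (∑ m : Fin N, (A₂ y k m : ℂ) * gp θ ψ m y) * gm θ ψ k y)
          + ((c₂ y : ℂ) - Λ) * ((‖ψ y‖ ^ 2 : ℝ) : ℂ)))
      = (∫ y in unitCell N, wform A₂ c₂ θ ψ ψ y)
        - ∫ y in unitCell N, Λ * (ψ y * conj (ψ y)) := by
    rw [← integral_sub (wform_integrable θ hA₂_reg hc₂_reg hψ_reg hψ_reg) iΛ]
    congr 1
    funext y
    have : ((‖ψ y‖ ^ 2 : ℝ) : ℂ) = ψ y * conj (ψ y) := by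
      rw [Complex.mul_conj, Complex.normSq_eq_norm_sq]
    rw [this]
    unfold wform flux
    ring
  rw [h0]
  change _ + (∫ y in unitCell N, wform A₁h c₁h θ χl ψ y)
    + (∫ y in unitCell N, wform A₁l c₁l θ χh ψ y) = 0
  linear_combination -hS
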